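/- Let f₁,…,f_r, g₁,…,g_s ∈ ℝ[x₁,…,xₙ], let K = {x ∈ ℝⁿ : fᵢ(x) ≥ 0 for i = 1,…,r and gⱼ(x) = 0 for j = 1,…,s}, and let P_S be the associated preorder. Then K = ∅ if and only if −1 ∈ P_S. -/

import Mathlib

/-- A polynomial is a sum of squares. -/
def IsSOS {n : ℕ} (s : MvPolynomial (Fin n) ℝ) : Prop :=
  ∃ (k : ℕ) (p : Fin k → MvPolynomial (Fin n) ℝ), s = ∑ i, (p i) ^ 2

/-- Membership in the preorder generated by inequalities `f₁,…,f_r` and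
equations `g₁,…,g_s`: `q = ∑_{ε ∈ {0,1}^r} s_ε f₁^{ε₁}⋯f_r^{ε_r} + ∑ j pⱼ gⱼ`
with every `s_ε` SOS. -/
def InPreorder {n r s : ℕ} (f : Fin r → MvPolynomial (Fin n) ℝ)
    (g : Fin s → MvPolynomial (Fin n) ℝ) (q : MvPolynomial (Fin n) ℝ) : Prop :=
  ∃ (σ : (Fin r → Bool) → MvPolynomial (Fin n) ℝ)
    (p : Fin s → MvPolynomial (Fin n) ℝ),
    (∀ ε, IsSOS (σ ε)) ∧
    q = (∑ ε : Fin r → Bool, σ ε * ∏ i, if ε i then f i else 1) + ∑ j, p j * g j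


section
open Polynomial

/-- total cone with prime support -/
structure KSCone {A : Type} [CommRing A] (Q : Subsemiring A) : Prop where
  neg_one : (-1 : A) ∉ Q
  total : ∀ a, a ∈ Q ∨ -a ∈ Q
  prime : ∀ a b, a * b ∈ Q → -(a * b) ∈ Q → (a ∈ Q ∧ -a ∈ Q) ∨ (b ∈ Q ∧ -b ∈ Q)

/-- `Q + a Q` -/
def ksAdj {A : Type} [CommRing A] (Q : Subsemiring A) (hsq : ∀ a : A, a * a ∈ Q) (a : A) :
    Subsemiring A where
  carrier := {x | ∃ s ∈ Q, ∃ t ∈ Q, x = s + a * t}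
  zero_mem' := ⟨0, Q.zero_mem, 0, Q.zero_mem, by simp⟩
  one_mem' := ⟨1, Q.one_mem, 0, Q.zero_mem, by simp⟩
  add_mem' := by
    rintro _ _ ⟨s, hs, t, ht, rfl⟩ ⟨s', hs', t', ht', rfl⟩
    exact ⟨s + s', Q.add_mem hs hs', t + t', Q.add_mem ht ht', by ring⟩
  mul_mem' := by
    rintro _ _ ⟨s, hs, t, ht, rfl⟩ ⟨s', hs', t', ht', rfl⟩
    exact ⟨s * s' + (a * a) * (t * t'),
      Q.add_mem (Q.mul_mem hs hs') (Q.mul_mem (hsq a) (Q.mul_mem ht ht')),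
      s * t' + t * s', Q.add_mem (Q.mul_mem hs ht') (Q.mul_mem ht hs'), by ring⟩

theorem ks_exists_cone {A : Type} [CommRing A] (T : Subsemiring A) (hsq : ∀ a : A, a * a ∈ T)
    (h1 : (-1 : A) ∉ T) : ∃ Q : Subsemiring A, T ≤ Q ∧ KSCone Q := by
  obtain ⟨Q, hTQ, hmax⟩ := zorn_le_nonempty₀ {Q : Subsemiring A | (-1 : A) ∉ Q} (by
    intro c hc hchain y hy
    refine ⟨sSup c, ?_, fun z hz => le_sSup hz⟩
    intro h
    obtain ⟨s, hs, h⟩ := (Subsemiring.mem_sSup_of_directedOn ⟨y, hy⟩ hchain.directedOn).1 h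
    exact hc hs h) T h1
  have hQ1 : (-1 : A) ∉ Q := hmax.prop
  have hsq' : ∀ a : A, a * a ∈ Q := fun a => hTQ (hsq a)
  have key : ∀ a, a ∉ Q → ∃ s ∈ Q, ∃ t ∈ Q, (-1 : A) = s + a * t := by
    intro a ha
    by_contra hcon
    have h2 : ksAdj Q hsq' a ≤ Q := hmax.le_of_ge (y := ksAdj Q hsq' a) hcon
      (fun x hx => ⟨x, hx, 0, Q.zero_mem, by simp⟩)
    exact ha (h2 ⟨0, Q.zero_mem, 1, Q.one_mem, by simp⟩)
  have tot : ∀ a, a ∈ Q ∨ -a ∈ Q := by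
    intro a
    by_contra! hcon
    obtain ⟨s, hs, t, ht, h⟩ := key a hcon.1
    obtain ⟨u, hu, v, hv, h'⟩ := key (-a) hcon.2
    apply hQ1
    have : (-1 : A) = s + u + s * u + (a * a) * (t * v) := by
      have e1 : a * t = -1 - s := by rw [h]; ring
      have e2 : a * v = 1 + u := by linear_combination h'
      linear_combination (-(a * v)) * e1 + (1 + s) * e2
    rw [this]
    exact Q.add_mem (Q.add_mem (Q.add_mem hs hu) (Q.mul_mem hs hu))
      (Q.mul_mem (hsq' a) (Q.mul_mem ht hv))
  refine ⟨Q, hTQ, hQ1, tot, ?_⟩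
  have main : ∀ a b, a ∉ Q → b ∉ Q → a * b ∈ Q → -(a * b) ∈ Q → False := by
    intro a b ha hb _ hab'
    obtain ⟨s, hs, t, ht, h⟩ := key a ha
    obtain ⟨u, hu, v, hv, h'⟩ := key b hb
    apply hQ1
    have : (-1 : A) = s + u + s * u + (-(a * b)) * (t * v) := by
      have e1 : a * t = -1 - s := by rw [h]; ring
      have e2 : b * v = -1 - u := by rw [h']; ring
      linear_combination (b * v) * e1 + (-1 - s) * e2
    rw [this]
    exact Q.add_mem (Q.add_mem (Q.add_mem hs hu) (Q.mul_mem hs hu))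
      (Q.mul_mem hab' (Q.mul_mem ht hv))
  intro a b hab hab'
  by_contra! hcon
  obtain ⟨ha, hb⟩ := hcon
  by_cases ha1 : a ∈ Q
  · have ha2 := ha ha1
    by_cases hb1 : b ∈ Q
    · exact main (-a) (-b) ha2 (hb hb1) (by simpa using hab) (by simpa using hab')
    · exact main (-a) b ha2 hb1 (by simpa using hab') (by simpa using hab)
  · by_cases hb1 : b ∈ Q
    · exact main a (-b) ha1 (hb hb1) (by simpa using hab') (by simpa using hab)
    · exact main a b ha1 hb1 hab hab'

/-- support -/
def ksSupp {A : Type} [CommRing A] (Q : Subsemiring A) (hQ : KSCone Q) : Ideal A where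
  carrier := {a | a ∈ Q ∧ -a ∈ Q}
  zero_mem' := ⟨Q.zero_mem, by simp⟩
  add_mem' := by
    rintro a b ⟨ha, ha'⟩ ⟨hb, hb'⟩
    exact ⟨Q.add_mem ha hb, by rw [neg_add]; exact Q.add_mem ha' hb'⟩
  smul_mem' := by
    rintro c a ⟨ha, ha'⟩
    simp only [smul_eq_mul]
    rcases hQ.total c with h | h
    · exact ⟨Q.mul_mem h ha, by simpa using Q.mul_mem h ha'⟩
    · exact ⟨by simpa using Q.mul_mem h ha', by simpa using Q.mul_mem h ha⟩

theorem ksSupp_prime {A : Type} [CommRing A] (Q : Subsemiring A) (hQ : KSCone Q) :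
    (ksSupp Q hQ).IsPrime := by
  refine ⟨?_, ?_⟩
  · intro h
    have : (1 : A) ∈ ksSupp Q hQ := by rw [h]; trivial
    exact hQ.neg_one this.2
  · intro a b hab
    exact hQ.prime a b hab.1 hab.2

/-- good cones in a field -/
structure KSGood {Ω : Type} [Field Ω] (P : Subsemiring Ω) : Prop where
  anti : ∀ a, a ∈ P → -a ∈ P → a = 0
  total : ∀ a ∈ P, ∀ b ∈ P, a - b ∈ P ∨ b - a ∈ P

theorem ks_good_map {A Ω : Type} [CommRing A] [Field Ω] (Q : Subsemiring A) (hQ : KSCone Q)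
    (φ : A →+* Ω) (hφ : RingHom.ker φ = ksSupp Q hQ) : KSGood (Q.map φ) := by
  constructor
  · rintro _ ⟨a, ha, rfl⟩ ⟨b, hb, hab⟩
    have h : a + b ∈ RingHom.ker φ := by
      rw [RingHom.mem_ker, map_add, hab]; ring
    rw [hφ] at h
    have : a ∈ RingHom.ker φ := by
      rw [hφ]
      refine ⟨ha, ?_⟩
      have := Q.add_mem hb h.2
      simpa using this
    exact this
  · rintro _ ⟨a, ha, rfl⟩ _ ⟨b, hb, rfl⟩
    rcases hQ.total (a - b) with h | h
    · exact Or.inl ⟨a - b, h, by simp⟩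
    · exact Or.inr ⟨-(a - b), h, by simp⟩

theorem ks_good_max {Ω : Type} [Field Ω] (P : Subsemiring Ω) (hP : KSGood P) :
    ∃ P', P ≤ P' ∧ Maximal (fun P => KSGood P) P' := by
  refine zorn_le_nonempty₀ {P : Subsemiring Ω | KSGood P} ?_ P hP
  intro c hc hchain y hy
  have hm : ∀ x, x ∈ sSup c ↔ ∃ s ∈ c, x ∈ s := fun x =>
    Subsemiring.mem_sSup_of_directedOn ⟨y, hy⟩ hchain.directedOn
  refine ⟨sSup c, ⟨?_, ?_⟩, fun z hz => le_sSup hz⟩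
  · intro a ha ha'
    obtain ⟨s, hs, h⟩ := (hm _).1 ha
    obtain ⟨s', hs', h'⟩ := (hm _).1 ha'
    obtain ⟨u, hu, h1, h2⟩ := hchain.directedOn s hs s' hs'
    exact (hc hu).anti a (h1 h) (h2 h')
  · intro a ha b hb
    obtain ⟨s, hs, h⟩ := (hm _).1 ha
    obtain ⟨s', hs', h'⟩ := (hm _).1 hb
    obtain ⟨u, hu, h1, h2⟩ := hchain.directedOn s hs s' hs'
    rcases (hc hu).total a (h1 h) b (h2 h') with h3 | h3
    · exact Or.inl (le_sSup hu h3)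
    · exact Or.inr (le_sSup hu h3)

/-- intermediate value property for polynomials -/
def KSIVT (R : Type) [Field R] [LinearOrder R] : Prop :=
  ∀ (p : R[X]) (a b : R), a < b → p.eval a * p.eval b < 0 → ∃ c, a < c ∧ c < b ∧ p.eval c = 0


theorem ks_inv_mem {Ω : Type} [Field Ω] (P : Subsemiring Ω)
    (hP : Maximal (fun P => KSGood P) P) (a : Ω) (ha : a ∈ P) : a⁻¹ ∈ P := by
  let P' : Subsemiring Ω :=
    { carrier := {x | ∃ c ∈ P, c ≠ 0 ∧ x * c ∈ P}
      zero_mem' := ⟨1, P.one_mem, one_ne_zero, by simp⟩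
      one_mem' := ⟨1, P.one_mem, one_ne_zero, by simp⟩
      add_mem' := by
        rintro x y ⟨c, hc, hc0, hx⟩ ⟨d, hd, hd0, hy⟩
        refine ⟨c * d, P.mul_mem hc hd, mul_ne_zero hc0 hd0, ?_⟩
        have := P.add_mem (P.mul_mem hx hd) (P.mul_mem hy hc)
        convert this using 1; ring
      mul_mem' := by
        rintro x y ⟨c, hc, hc0, hx⟩ ⟨d, hd, hd0, hy⟩
        refine ⟨c * d, P.mul_mem hc hd, mul_ne_zero hc0 hd0, ?_⟩
        have := (P.mul_mem hx hy)
        convert this using 1; ring }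
  have hg : KSGood P' := by
    constructor
    · rintro x ⟨c, hc, hc0, hx⟩ ⟨d, hd, hd0, hy⟩
      have := hP.prop.anti (x * c * d) (P.mul_mem hx hd) (by
        have := P.mul_mem hy hc
        convert this using 1; ring)
      simpa [hc0, hd0] using this
    · rintro x ⟨c, hc, hc0, hx⟩ y ⟨d, hd, hd0, hy⟩
      rcases hP.prop.total _ (P.mul_mem hx hd) _ (P.mul_mem hy hc) with h | h
      · exact Or.inl ⟨c * d, P.mul_mem hc hd, mul_ne_zero hc0 hd0, by convert h using 1; ring⟩
      · exact Or.inr ⟨c * d, P.mul_mem hc hd, mul_ne_zero hc0 hd0, by convert h using 1; ring⟩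
  by_cases h0 : a = 0
  · subst h0; simp
  have hle : P' ≤ P := hP.le_of_ge hg (fun x hx => ⟨1, P.one_mem, one_ne_zero, by simpa using hx⟩)
  exact hle ⟨a, ha, h0, by rw [inv_mul_cancel₀ h0]; exact P.one_mem⟩

/-- the subfield -/
def ksField {Ω : Type} [Field Ω] (P : Subsemiring Ω)
    (hP : Maximal (fun P => KSGood P) P) : Subfield Ω where
  carrier := {x | x ∈ P ∨ -x ∈ P}
  zero_mem' := Or.inl P.zero_mem
  one_mem' := Or.inl P.one_mem
  neg_mem' := by
    rintro x (h | h)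
    · right; simpa using h
    · left; exact h
  inv_mem' := by
    rintro x (h | h)
    · exact Or.inl (ks_inv_mem P hP x h)
    · right; rw [← inv_neg]; exact ks_inv_mem P hP _ h
  add_mem' := by
    rintro x y (h | h) (h' | h')
    · exact Or.inl (P.add_mem h h')
    · rcases hP.prop.total _ h _ h' with h2 | h2
      · left; simpa using h2
      · right; convert h2 using 1; ring
    · rcases hP.prop.total _ h _ h' with h2 | h2
      · right; convert h2 using 1; ring
      · left; convert h2 using 1; ring
    · right; rw [neg_add]; exact P.add_mem h h'
  mul_mem' := by
    rintro x y (h | h) (h' | h')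
    · exact Or.inl (P.mul_mem h h')
    · right; simpa using P.mul_mem h h'
    · right; simpa using P.mul_mem h h'
    · left; simpa using P.mul_mem h h'

theorem ks_order_exists {Ω : Type} [Field Ω] (P : Subsemiring Ω)
    (hP : Maximal (fun P => KSGood P) P) : ∃ (_ : LinearOrder (ksField P hP)), IsStrictOrderedRing (ksField P hP) ∧
    ∀ x : ksField P hP, 0 ≤ x ↔ (x : Ω) ∈ P := by
  classical
  let C : RingCone (ksField P hP) :=
    { P.comap (ksField P hP).subtype with
      eq_zero_of_mem_of_neg_mem' := by
        intro a ha ha'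
        apply Subtype.ext
        exact hP.prop.anti _ ha ha' }
  have hmem : ∀ x, x ∈ C ↔ (x : Ω) ∈ P := fun x => Iff.rfl
  have : HasMemOrNegMem C := ⟨fun a => a.2⟩
  let l : LinearOrder (ksField P hP) := LinearOrder.mkOfAddGroupCone C
  have ho : IsOrderedRing (ksField P hP) := IsOrderedRing.mkOfCone C
  refine ⟨l, ?_, ?_⟩
  · exact IsOrderedRing.toIsStrictOrderedRing _
  · intro x
    change x - 0 ∈ C ↔ _
    rw [sub_zero]; exact hmem x

/-- nonneg scalars times squares -/
def ksMon (R : Type) [Field R] [LinearOrder R] [IsStrictOrderedRing R] : Submonoid R[X] where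
  carrier := {q | ∃ c : R, 0 ≤ c ∧ ∃ t : R[X], q = C c * (t * t)}
  one_mem' := ⟨1, zero_le_one, 1, by simp⟩
  mul_mem' := by
    rintro _ _ ⟨c, hc, t, rfl⟩ ⟨d, hd, u, rfl⟩
    exact ⟨c * d, mul_nonneg hc hd, t * u, by rw [C_mul]; ring⟩

theorem ks_reduce {R : Type} [Field R] [LinearOrder R] [IsStrictOrderedRing R] (p : R[X])
    (hp : 0 < p.natDegree) (s : R[X]) (hs : s ∈ (ksMon R).subsemiringClosure) :
    ∃ s' h : R[X], s = s' + p * h ∧ s'.natDegree ≤ 2 * (p.natDegree - 1) ∧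
      ∀ x, 0 ≤ s'.eval x := by
  rw [Submonoid.subsemiringClosure_mem] at hs
  induction hs using AddSubmonoid.closure_induction with
  | mem q hq =>
    obtain ⟨c, hc, t, rfl⟩ := hq
    refine ⟨C c * ((t % p) * (t % p)), C c * (2 * (t % p) * (t / p) + p * (t / p) * (t / p)),
      ?_, ?_, ?_⟩
    · have h := EuclideanDomain.mod_add_div t p
      generalize t % p = u at *
      generalize t / p = v at *
      rw [← h]; ring
    · have h1 : (t % p).natDegree ≤ p.natDegree - 1 := by
        have := natDegree_mod_lt t hp.ne'
        omega
      refine (natDegree_C_mul_le _ _).trans (natDegree_mul_le.trans ?_)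
      omega
    · intro x
      simp only [eval_mul, eval_C]
      exact mul_nonneg hc (mul_self_nonneg _)
  | zero => exact ⟨0, 0, by simp, by simp, by simp⟩
  | add a b _ _ ha hb =>
    obtain ⟨s, h, h1, h2, h3⟩ := ha
    obtain ⟨s', h', h1', h2', h3'⟩ := hb
    refine ⟨s + s', h + h', by rw [h1, h1']; ring, (natDegree_add_le _ _).trans (max_le h2 h2'), ?_⟩
    intro x
    rw [eval_add]; exact add_nonneg (h3 x) (h3' x)

/-- adding an ideal -/
def ksPlus {A : Type} [CommRing A] (S : Subsemiring A) (p : A) : Subsemiring A where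
  carrier := {x | ∃ s ∈ S, ∃ h, x = s + p * h}
  zero_mem' := ⟨0, S.zero_mem, 0, by simp⟩
  one_mem' := ⟨1, S.one_mem, 0, by simp⟩
  add_mem' := by
    rintro _ _ ⟨s, hs, t, rfl⟩ ⟨s', hs', t', rfl⟩
    exact ⟨s + s', S.add_mem hs hs', t + t', by ring⟩
  mul_mem' := by
    rintro _ _ ⟨s, hs, t, rfl⟩ ⟨s', hs', t', rfl⟩
    exact ⟨s * s', S.mul_mem hs hs', s * t' + t * s' + p * t * t', by ring⟩

theorem ks_natDegree_pos {R : Type} [Field R] [LinearOrder R] [IsStrictOrderedRing R] (p : R[X])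
    (a b : R) (h : p.eval a * p.eval b < 0) : 0 < p.natDegree := by
  by_contra hn
  obtain ⟨c, hc⟩ := natDegree_eq_zero.1 (by omega : p.natDegree = 0)
  rw [← hc] at h
  simp only [eval_C] at h
  exact absurd h (not_lt.2 (mul_self_nonneg c))

theorem ks_neg_one_not {R : Type} [Field R] [LinearOrder R] [IsStrictOrderedRing R] (p : R[X])
    (a b : R) (hab : p.eval a * p.eval b < 0)
    (ih : ∀ q : R[X], q.natDegree < p.natDegree → q.eval a * q.eval b < 0 → ∃ c, q.eval c = 0) :
    (-1 : R[X]) ∉ ksPlus (ksMon R).subsemiringClosure p := by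
  rintro ⟨s, hs, h, e⟩
  have hd := ks_natDegree_pos p a b hab
  obtain ⟨s', h', e1, e2, e3⟩ := ks_reduce p hd s hs
  have e4 : s' + 1 = p * (-(h + h')) := by
    rw [e1] at e; linear_combination -e
  generalize -(h + h') = g at e4
  have ev : ∀ x, 0 < p.eval x * g.eval x := by
    intro x
    have := congrArg (eval x) e4
    simp only [eval_add, eval_one, eval_mul] at this
    rw [← this]; linarith [e3 x]
  have hp0 : p ≠ 0 := by rintro rfl; simp at hd
  have hg0 : g ≠ 0 := by rintro rfl; simpa using ev 0
  have hdeg : p.natDegree + g.natDegree ≤ 2 * (p.natDegree - 1) := by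
    rw [← natDegree_mul hp0 hg0, ← e4]
    refine (natDegree_add_le _ _).trans (max_le e2 (by simp))
  obtain ⟨c, hc⟩ := ih g (by omega) (by
    have h1 := ev a
    have h2 := ev b
    have h3 := mul_pos h1 h2
    have h4 : (p.eval a * p.eval b) * (g.eval a * g.eval b) > 0 := by linarith [h3]
    by_contra hcon
    exact absurd h4 (not_lt.2 (mul_nonpos_of_nonpos_of_nonneg hab.le (not_lt.1 hcon))))
  have := ev c
  rw [hc] at this; simp at this

/-- from weak to strong IVT -/
theorem ks_ivt_of_weak {R : Type} [Field R] [LinearOrder R] [IsStrictOrderedRing R]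
    (hw : ∀ (p : R[X]) (a b : R), p.eval a * p.eval b < 0 → ∃ c, p.eval c = 0) : KSIVT R := by
  intro p a b hab h
  induction hn : p.natDegree using Nat.strong_induction_on generalizing p with
  | _ n ih =>
  obtain ⟨c, hc⟩ := hw p a b h
  by_cases hin : a < c ∧ c < b
  · exact ⟨c, hin.1, hin.2, hc⟩
  obtain ⟨q, hq⟩ := dvd_iff_isRoot.2 hc
  have hp0 : p ≠ 0 := by rintro rfl; simp at h
  have hq0 : q ≠ 0 := by rintro rfl; simp at hq; exact hp0 hq
  have hd : p.natDegree = 1 + q.natDegree := by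
    rw [hq, natDegree_mul (X_sub_C_ne_zero c) hq0, natDegree_X_sub_C]
  rw [hq] at h
  simp only [eval_mul, eval_sub, eval_X, eval_C] at h
  have hpos : 0 ≤ (a - c) * (b - c) := by
    by_cases h1 : a < c
    · have h2 : b ≤ c := not_lt.1 fun h2 => hin ⟨h1, h2⟩
      exact mul_nonneg_of_nonpos_of_nonpos (by linarith) (by linarith)
    · exact mul_nonneg (by linarith) (by linarith)
  have h' : q.eval a * q.eval b < 0 := by
    by_contra hcon
    have := mul_nonneg hpos (not_lt.1 hcon)
    nlinarith
  obtain ⟨d, h1, h2, h3⟩ := ih q.natDegree (by omega) q h' rfl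
  exact ⟨d, h1, h2, by rw [hq]; simp [h3]⟩

theorem ks_weak {Ω : Type} [Field Ω] [IsAlgClosed Ω] (P : Subsemiring Ω)
    (hP : Maximal (fun P => KSGood P) P) [LinearOrder (ksField P hP)]
    [IsStrictOrderedRing (ksField P hP)] (ho : ∀ x : ksField P hP, 0 ≤ x ↔ (x : Ω) ∈ P)
    (p : (ksField P hP)[X]) (a b : ksField P hP) (hab : p.eval a * p.eval b < 0) :
    ∃ c, p.eval c = 0 := by
  induction hn : p.natDegree using Nat.strong_induction_on generalizing p with
  | _ n ih =>
  subst hn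
  have hd := ks_natDegree_pos p a b hab
  have hp0 : p ≠ 0 := by rintro rfl; simp at hd
  have h1 := ks_neg_one_not p a b hab (fun q hq hq' => ih _ hq q hq' rfl)
  obtain ⟨Q, hTQ, hQ⟩ := ks_exists_cone _ (by
    intro t
    refine ⟨t * t, ?_, 0, by simp⟩
    rw [Submonoid.subsemiringClosure_mem]
    exact AddSubmonoid.subset_closure ⟨1, zero_le_one, t, by simp⟩) h1
  have hprime := ksSupp_prime Q hQ
  have hpmem : p ∈ ksSupp Q hQ :=
    ⟨hTQ ⟨0, Subsemiring.zero_mem _, 1, by simp⟩, hTQ ⟨0, Subsemiring.zero_mem _, -1, by simp⟩⟩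
  have hne : ksSupp Q hQ ≠ ⊥ := by
    intro h; rw [h] at hpmem; exact hp0 (by simpa using hpmem)
  have hmaxl : (ksSupp Q hQ).IsMaximal := hprime.isMaximal hne
  obtain ⟨m, hm⟩ := (IsPrincipalIdealRing.principal (ksSupp Q hQ)).principal
  have hmdeg : m.degree ≠ 0 := by
    intro h
    have hu : IsUnit m := isUnit_iff_degree_eq_zero.2 h
    apply hprime.ne_top
    rw [hm]; exact Ideal.span_singleton_eq_top.2 hu
  obtain ⟨θ, hθ⟩ := IsAlgClosed.exists_eval₂_eq_zero (ksField P hP).subtype m hmdeg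
  let ψ : (ksField P hP)[X] →+* Ω := eval₂RingHom (ksField P hP).subtype θ
  have hker : RingHom.ker ψ = ksSupp Q hQ := by
    symm
    apply hmaxl.eq_of_le (RingHom.ker_ne_top ψ)
    rw [hm]
    refine (Ideal.span_singleton_le_iff_mem _).2 ?_
    exact hθ
  have hgood := ks_good_map Q hQ ψ hker
  have hle : Q.map ψ ≤ P := by
    refine hP.le_of_ge hgood ?_
    intro x hx
    refine ⟨C (⟨x, Or.inl hx⟩ : ksField P hP), hTQ ⟨C (⟨x, Or.inl hx⟩ : ksField P hP), ?_, 0, by simp⟩, ?_⟩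
    · rw [Submonoid.subsemiringClosure_mem]
      exact AddSubmonoid.subset_closure ⟨⟨x, Or.inl hx⟩, (ho ⟨x, Or.inl hx⟩).2 hx, 1, by simp⟩
    · simp [ψ]
  have hθL : θ ∈ ksField P hP := by
    rcases hQ.total X with h | h
    · left; exact hle ⟨X, h, by simp [ψ]⟩
    · right; exact hle ⟨-X, h, by simp [ψ]⟩
  refine ⟨⟨θ, hθL⟩, ?_⟩
  have hpk : ψ p = 0 := by
    have : p ∈ RingHom.ker ψ := by rw [hker]; exact hpmem
    exact this
  apply Subtype.ext
  have := Polynomial.hom_eval₂ p (RingHom.id _) (ksField P hP).subtype ⟨θ, hθL⟩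
  rw [eval, ← Subfield.coe_subtype, this]
  simpa [ψ] using hpk

theorem ks_real_closure {A : Type} [CommRing A] (Q : Subsemiring A) (hQ : KSCone Q) :
    ∃ (R : Type) (_ : Field R) (_ : LinearOrder R) (_ : IsStrictOrderedRing R) (φ : A →+* R),
      KSIVT R ∧ ∀ a ∈ Q, 0 ≤ φ a := by
  have hprime := ksSupp_prime Q hQ
  let F := FractionRing (A ⧸ ksSupp Q hQ)
  let Ω := AlgebraicClosure F
  let φ : A →+* Ω := ((algebraMap F Ω).comp (algebraMap (A ⧸ ksSupp Q hQ) F)).comp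
    (Ideal.Quotient.mk (ksSupp Q hQ))
  have hker : RingHom.ker φ = ksSupp Q hQ := by
    ext x
    rw [RingHom.mem_ker, ← Ideal.Quotient.eq_zero_iff_mem]
    have hinj : Function.Injective ((algebraMap F Ω).comp (algebraMap (A ⧸ ksSupp Q hQ) F)) :=
      (algebraMap F Ω).injective.comp (IsFractionRing.injective _ _)
    exact map_eq_zero_iff _ hinj
  obtain ⟨P, hle, hP⟩ := ks_good_max _ (ks_good_map Q hQ φ hker)
  obtain ⟨l, hs, ho⟩ := ks_order_exists P hP
  have hmem : ∀ a, φ a ∈ ksField P hP := by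
    intro a
    rcases hQ.total a with h | h
    · left; exact hle ⟨a, h, rfl⟩
    · right; exact hle ⟨-a, h, by simp⟩
  refine ⟨ksField P hP, inferInstance, l, hs, φ.codRestrict (ksField P hP) hmem, ?_, ?_⟩
  · exact ks_ivt_of_weak (fun p a b h => ks_weak P hP ho p a b h)
  · intro a ha
    exact (ho _).2 (hle ⟨a, ha, rfl⟩)


section
variable {R : Type} [Field R] [LinearOrder R] [IsStrictOrderedRing R]

theorem ks_sign_lt (hR : KSIVT R) (p : R[X]) (a b : R) (hab : a ≤ b)
    (h : ∀ x, a ≤ x → x ≤ b → p.eval x ≠ 0) : 0 < p.eval a * p.eval b := by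
  rcases hab.eq_or_lt with rfl | hlt
  · exact mul_self_pos.2 (h a le_rfl le_rfl)
  by_contra hcon
  have h0 : p.eval a * p.eval b ≠ 0 := mul_ne_zero (h a le_rfl hab) (h b hab le_rfl)
  obtain ⟨c, h1, h2, h3⟩ := hR p a b hlt (lt_of_le_of_ne (not_lt.1 hcon) h0)
  exact h c h1.le h2.le h3

theorem ks_sign_iff (hR : KSIVT R) (p : R[X]) (a b : R)
    (h : ∀ x ∈ Set.uIcc a b, p.eval x ≠ 0) : 0 < p.eval a ↔ 0 < p.eval b := by
  have key : 0 < p.eval a * p.eval b := by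
    rcases le_total a b with hab | hab
    · exact ks_sign_lt hR p a b hab fun x h1 h2 => h x (by rw [Set.uIcc_of_le hab]; exact ⟨h1, h2⟩)
    · rw [mul_comm]
      exact ks_sign_lt hR p b a hab fun x h1 h2 => h x (by rw [Set.uIcc_of_ge hab]; exact ⟨h1, h2⟩)
  rcases mul_pos_iff.1 key with h | h
  · exact ⟨fun _ => h.2, fun _ => h.1⟩
  · exact ⟨fun h' => absurd h' h.1.not_gt, fun h' => absurd h' h.2.not_gt⟩

theorem ks_rolle (hR : KSIVT R) (p : R[X]) (a b : R) (hab : a < b)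
    (ha : p.eval a = 0) (hb : p.eval b = 0) : ∃ c, a < c ∧ c < b ∧ p.derivative.eval c = 0 := by
  classical
  by_cases hp0 : p = 0
  · subst hp0
    obtain ⟨c, h1, h2⟩ := exists_between hab
    exact ⟨c, h1, h2, by simp⟩
  -- next root
  obtain ⟨b', hb', hmin⟩ := Finset.exists_min_image (p.roots.toFinset.filter (fun x => a < x)) id
    ⟨b, by simp [hp0, hb, hab]⟩
  simp only [Finset.mem_filter, Multiset.mem_toFinset, mem_roots hp0, IsRoot.def, id] at hb' hmin
  have hb'b : b' ≤ b := hmin b ⟨hb, hab⟩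
  obtain ⟨hb'0, hab'⟩ := hb'
  obtain ⟨q1, hq1, hq1'⟩ := exists_eq_pow_rootMultiplicity_mul_and_not_dvd p hp0 a
  have hm : 0 < rootMultiplicity a p := (rootMultiplicity_pos hp0).2 ha
  obtain ⟨m, hm'⟩ := Nat.exists_eq_add_of_lt hm
  rw [hm'] at hq1
  have hq10 : q1 ≠ 0 := by rintro rfl; simp at hq1'
  obtain ⟨q, hq, hq'⟩ := exists_eq_pow_rootMultiplicity_mul_and_not_dvd q1 hq10 b'
  have hq1b : q1.eval b' = 0 := by
    rw [hq1] at hb'0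
    simp only [eval_mul, eval_pow, eval_sub, eval_X, eval_C] at hb'0
    rcases mul_eq_zero.1 hb'0 with h | h
    · exact absurd (pow_eq_zero_iff (by omega) |>.1 h) (sub_ne_zero.2 hab'.ne')
    · exact h
  have hn : 0 < rootMultiplicity b' q1 := (rootMultiplicity_pos hq10).2 hq1b
  obtain ⟨n, hn'⟩ := Nat.exists_eq_add_of_lt hn
  rw [hn'] at hq
  simp only [zero_add] at hq1 hq
  rw [dvd_iff_isRoot, IsRoot.def] at hq1' hq'
  have hpq : p = (X - C a) ^ (m + 1) * ((X - C b') ^ (n + 1) * q) := by rw [← hq, ← hq1]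
  have hqa : q.eval a ≠ 0 := by
    intro h; apply hq1'; rw [hq]; simp [h]
  have hqno : ∀ x, a ≤ x → x ≤ b' → q.eval x ≠ 0 := by
    intro x h1 h2 h3
    rcases h1.eq_or_lt with rfl | h1
    · exact hqa h3
    rcases h2.eq_or_lt with rfl | h2
    · exact hq' h3
    exact absurd (hmin x ⟨by rw [hpq]; simp [h3], h1⟩) (not_le.2 h2)
  have hpos := ks_sign_lt hR q a b' hab'.le hqno
  let g : R[X] := C ((m : R) + 1) * ((X - C b') * q) + C ((n : R) + 1) * ((X - C a) * q)
    + (X - C a) * (X - C b') * derivative q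
  have hder : derivative p = (X - C a) ^ m * (X - C b') ^ n * g := by
    rw [hpq]
    simp only [derivative_mul, derivative_X_sub_C_pow, g]
    simp only [Nat.cast_add, Nat.cast_one, add_tsub_cancel_right, C_add, C_1, map_natCast]
    ring
  obtain ⟨c, h1, h2, h3⟩ := hR g a b' hab' (by
    have e1 : g.eval a = ((m : R) + 1) * ((a - b') * q.eval a) := by simp [g]
    have e2 : g.eval b' = ((n : R) + 1) * ((b' - a) * q.eval b') := by simp [g]
    rw [e1, e2]
    have : (0 : R) < ((m : R) + 1) * ((n : R) + 1) * ((b' - a) * (b' - a)) *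
        (q.eval a * q.eval b') := by
      have := sub_pos.2 hab'
      positivity
    nlinarith)
  exact ⟨c, h1, h2.trans_le hb'b, by rw [hder]; simp [h3]⟩

theorem ks_unique (hR : KSIVT R) (p : R[X]) (a b : R)
    (hd : ∀ x, a < x → x < b → p.derivative.eval x ≠ 0) (x y : R) (hax : a ≤ x) (hxb : x ≤ b)
    (hay : a ≤ y) (hyb : y ≤ b) (hx : p.eval x = 0) (hy : p.eval y = 0) : x = y := by
  rcases lt_trichotomy x y with h | h | h
  · obtain ⟨c, h1, h2, h3⟩ := ks_rolle hR p x y h hx hy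
    exact absurd h3 (hd c (hax.trans_lt h1) (h2.trans_le hyb))
  · exact h
  · obtain ⟨c, h1, h2, h3⟩ := ks_rolle hR p y x h hy hx
    exact absurd h3 (hd c (hay.trans_lt h1) (h2.trans_le hxb))

theorem ks_change (hR : KSIVT R) (p : R[X]) (a b θ : R)
    (hd : ∀ x, a < x → x < b → p.derivative.eval x ≠ 0) (hθ : p.eval θ = 0)
    (haθ : a < θ) (hθb : θ < b) : p.eval a * p.eval b < 0 := by
  obtain ⟨q, hq⟩ := dvd_iff_isRoot.2 hθ
  have hder : p.derivative.eval θ = q.eval θ := by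
    rw [hq]; simp [derivative_mul]
  have hqθ : q.eval θ ≠ 0 := by rw [← hder]; exact hd θ haθ hθb
  have hno : ∀ x, a ≤ x → x ≤ b → q.eval x ≠ 0 := by
    intro x h1 h2 h3
    have : x = θ := ks_unique hR p a b hd x θ h1 h2 haθ.le hθb.le (by rw [hq]; simp [h3]) hθ
    rw [this] at h3; exact hqθ h3
  have hpos := ks_sign_lt hR q a b (haθ.trans hθb).le hno
  have e1 : p.eval a = (a - θ) * q.eval a := by rw [hq]; simp
  have e2 : p.eval b = (b - θ) * q.eval b := by rw [hq]; simp
  rw [e1, e2]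
  have : 0 < (θ - a) * (b - θ) * (q.eval a * q.eval b) :=
    mul_pos (mul_pos (sub_pos.2 haθ) (sub_pos.2 hθb)) hpos
  nlinarith

variable {k : Type} [Field k]

theorem ks_bracket (α : k →+* R) (E : Finset R) (hE : ∀ e ∈ E, ∃ u, α u = e) (θ : R) (hθ : θ ∉ E)
    (hlo : ∃ e ∈ E, e < θ) (hhi : ∃ e ∈ E, θ < e) :
    ∃ u v, α u ∈ E ∧ α v ∈ E ∧ α u < θ ∧ θ < α v ∧ ∀ e ∈ E, α u < e → e < α v → False := by
  classical
  obtain ⟨a, ha, ha'⟩ := Finset.exists_max_image (E.filter (fun x => x < θ)) id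
    (by obtain ⟨e, h1, h2⟩ := hlo; exact ⟨e, by simp [h1, h2]⟩)
  obtain ⟨b, hb, hb'⟩ := Finset.exists_min_image (E.filter (fun x => θ < x)) id
    (by obtain ⟨e, h1, h2⟩ := hhi; exact ⟨e, by simp [h1, h2]⟩)
  simp only [Finset.mem_filter, id] at ha ha' hb hb'
  obtain ⟨u, rfl⟩ := hE a ha.1
  obtain ⟨v, rfl⟩ := hE b hb.1
  refine ⟨u, v, ha.1, hb.1, ha.2, hb.2, ?_⟩
  intro e he h1 h2
  rcases lt_trichotomy e θ with h | h | h
  · exact absurd (ha' e ⟨he, h⟩) (not_le.2 h1)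
  · exact hθ (h ▸ he)
  · exact absurd (hb' e ⟨he, h⟩) (not_le.2 h2)

theorem ks_mid {R k : Type} [Field R] [LinearOrder R] [IsStrictOrderedRing R] [Field k]
    (α : k →+* R) (u v : k) (h : α u < α v) : α u < α ((u + v) / 2) ∧ α ((u + v) / 2) < α v := by
  rw [map_div₀, map_add, map_ofNat]
  constructor <;> linarith

theorem ks_near (α : k →+* R) (E : Finset R) (hE : ∀ e ∈ E, ∃ u, α u = e) (θ : R) (hθ : θ ∉ E) :
    ∃ c, ∀ e ∈ E, e ∉ Set.uIcc θ (α c) := by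
  classical
  by_cases hlo : ∃ e ∈ E, e < θ
  · by_cases hhi : ∃ e ∈ E, θ < e
    · obtain ⟨u, v, -, -, h1, h2, h3⟩ := ks_bracket α E hE θ hθ hlo hhi
      obtain ⟨h4, h5⟩ := ks_mid α u v (h1.trans h2)
      refine ⟨(u + v) / 2, fun e he hmem => ?_⟩
      rw [Set.mem_uIcc] at hmem
      rcases hmem with h | h
      · exact h3 e he (h1.trans_le h.1) (h.2.trans_lt h5)
      · exact h3 e he (h4.trans_le h.1) (h.2.trans_lt h2)
    · push Not at hhi
      obtain ⟨a, ha, ha'⟩ := Finset.exists_max_image E id (by obtain ⟨e, h, -⟩ := hlo; exact ⟨e, h⟩)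
      obtain ⟨u, rfl⟩ := hE a ha
      refine ⟨u + 1, fun e he hmem => ?_⟩
      have h1 := ha' e he
      have h2 := hhi e he
      have h3 : e ≠ θ := fun h => hθ (h ▸ he)
      have h4 := lt_of_le_of_ne h2 h3
      rw [Set.mem_uIcc, map_add, map_one] at hmem
      simp only [id] at h1
      rcases hmem with h | h <;> linarith [h.1, h.2]
  · push Not at hlo
    by_cases hne : E.Nonempty
    · obtain ⟨a, ha, ha'⟩ := Finset.exists_min_image E id hne
      obtain ⟨u, rfl⟩ := hE a ha
      refine ⟨u - 1, fun e he hmem => ?_⟩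
      have h1 := ha' e he
      have h2 := hlo e he
      have h3 : e ≠ θ := fun h => hθ (h ▸ he)
      have h4 := lt_of_le_of_ne h2 h3.symm
      rw [Set.mem_uIcc, map_sub, map_one] at hmem
      simp only [id] at h1
      rcases hmem with h | h <;> linarith [h.1, h.2]
    · exact ⟨0, fun e he => absurd ⟨e, he⟩ hne⟩

theorem ks_bound (α : k →+* R) (p : k[X]) (hp : p ≠ 0) (θ : R) (h : eval₂ α θ p = 0) :
    ∃ u, |θ| < α u := by
  have habs : ∀ a : k, ∃ w, α w = |α a| := by
    intro a
    rcases abs_choice (α a) with h | h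
    · exact ⟨a, h.symm⟩
    · exact ⟨-a, by rw [h, map_neg]⟩
  choose w hw using habs
  let q := p * C p.leadingCoeff⁻¹
  have hq : q.Monic := monic_mul_leadingCoeff_inv hp
  have hqe : eval₂ α θ q = 0 := by simp [q, eval₂_mul, h]
  by_cases h1 : |θ| < 1
  · exact ⟨1, by simpa using h1⟩
  push Not at h1
  refine ⟨(∑ i ∈ Finset.range q.natDegree, w (q.coeff i)) + 1, ?_⟩
  rw [map_add, map_one, map_sum]
  simp only [hw]
  apply lt_add_of_le_of_pos _ one_pos
  rw [hq.as_sum, eval₂_add, eval₂_X_pow, eval₂_finsetSum] at hqe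
  simp only [eval₂_mul, eval₂_C, eval₂_X_pow] at hqe
  have hd : q.natDegree ≠ 0 := by
    intro h0; rw [h0] at hqe; simp at hqe
  obtain ⟨d, hd'⟩ := Nat.exists_eq_succ_of_ne_zero hd
  rw [hd'] at hqe ⊢
  have e : θ ^ (d + 1) = - ∑ i ∈ Finset.range (d + 1), α (q.coeff i) * θ ^ i :=
    eq_neg_of_add_eq_zero_left hqe
  have h2 : |θ| ^ (d + 1) ≤ (∑ i ∈ Finset.range (d + 1), |α (q.coeff i)|) * |θ| ^ d := by
    rw [← abs_pow, e, abs_neg, Finset.sum_mul]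
    refine (Finset.abs_sum_le_sum_abs _ _).trans (Finset.sum_le_sum fun i hi => ?_)
    rw [abs_mul, abs_pow]
    refine mul_le_mul_of_nonneg_left (pow_le_pow_right₀ h1 ?_) (abs_nonneg _)
    have := Finset.mem_range.1 hi
    omega
  rw [pow_succ'] at h2
  exact le_of_mul_le_mul_right h2 (pow_pos (by linarith) d)

end

/-- elements algebraic of degree < d are in the range -/
def KSClosed {R k : Type} [Field R] [Field k] (α : k →+* R) (d : ℕ) : Prop :=
  ∀ p : k[X], p ≠ 0 → p.natDegree < d → ∀ x, eval₂ α x p = 0 → ∃ u, α u = x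


section
variable {R S k : Type} [Field R] [LinearOrder R] [IsStrictOrderedRing R]
  [Field S] [LinearOrder S] [IsStrictOrderedRing S] [Field k]

theorem ks_lt_iff (α : k →+* R) (β : k →+* S) (hs : ∀ a, 0 < α a ↔ 0 < β a) (u v : k) :
    α u < α v ↔ β u < β v := by
  rw [← sub_pos, ← map_sub, hs, map_sub, sub_pos]

theorem ks_neg_iff (α : k →+* R) (β : k →+* S) (hs : ∀ a, 0 < α a ↔ 0 < β a) (u : k) :
    α u < 0 ↔ β u < 0 := by
  have := ks_lt_iff α β hs u 0
  simpa using this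

theorem ks_alg_step (hR : KSIVT R) (hS : KSIVT S) (α : k →+* R) (β : k →+* S)
    (hs : ∀ a, 0 < α a ↔ 0 < β a) (p : k[X]) (hp : p ≠ 0)
    (hcα : KSClosed α p.natDegree) (hcβ : KSClosed β p.natDegree)
    (θ : R) (hθ : eval₂ α θ p = 0) (hθr : ¬ ∃ u, α u = θ) :
    ∃ θ' : S, ∀ h : k[X], 0 < eval₂ α θ h ↔ 0 < eval₂ β θ' h := by
  classical
  have : CharZero k := by
    have := (RingHom.charZero_iff α.injective).2 (inferInstance : CharZero R)
    exact this
  have hd : 0 < p.natDegree := by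
    by_contra hn
    obtain ⟨c, rfl⟩ := natDegree_eq_zero.1 (by omega : p.natDegree = 0)
    simp at hθ; subst hθ; simp at hp
  have hp'0 : derivative p ≠ 0 := fun h => by
    have := natDegree_eq_zero_of_derivative_eq_zero h
    omega
  have hp'd : (derivative p).natDegree < p.natDegree := natDegree_derivative_lt hd.ne'
  have hmapα : ∀ (h : k[X]) x, eval x (h.map α) = eval₂ α x h := fun h x => eval_map _ _
  have hmapβ : ∀ (h : k[X]) x, eval x (h.map β) = eval₂ β x h := fun h x => eval_map _ _
  have hα0 : ∀ h : k[X], h ≠ 0 → h.map α ≠ 0 := fun h hh => (Polynomial.map_ne_zero_iff α.injective).2 hh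
  have hroot : ∀ (h : k[X]), h ≠ 0 → ∀ x, x ∈ (h.map α).roots.toFinset ↔ eval₂ α x h = 0 := by
    intro h hh x
    rw [Multiset.mem_toFinset, mem_roots (hα0 h hh), IsRoot.def, hmapα]
  have hck : ∀ (γ : k) (h : k[X]), eval₂ α (α γ) h = α (h.eval γ) := fun γ h => by
    rw [eval₂_at_apply]
  have hckβ : ∀ (γ : k) (h : k[X]), eval₂ β (β γ) h = β (h.eval γ) := fun γ h => by
    rw [eval₂_at_apply]
  -- a general bracketing
  obtain ⟨B, hB⟩ := ks_bound α p hp θ hθ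
  rw [abs_lt] at hB
  have brk : ∀ (h : k[X]), h ≠ 0 → h.natDegree < p.natDegree → ∀ a b : k, α a < θ → θ < α b →
      ∃ u v, α a ≤ α u ∧ α v ≤ α b ∧ α u < θ ∧ θ < α v ∧
        ∀ x, α u < x → x < α v → eval₂ α x h ≠ 0 := by
    intro h hh hdeg a b ha hb
    obtain ⟨u, v, h1, h2, h3, h4, h5⟩ := ks_bracket α
      (insert (α a) (insert (α b) (h.map α).roots.toFinset)) (by
        intro e he
        simp only [Finset.mem_insert, hroot h hh] at he
        rcases he with rfl | rfl | he
        · exact ⟨_, rfl⟩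
        · exact ⟨_, rfl⟩
        · exact hcα h hh hdeg e he) θ (by
        intro he
        simp only [Finset.mem_insert, hroot h hh] at he
        rcases he with he | he | he
        · exact hθr ⟨_, he.symm⟩
        · exact hθr ⟨_, he.symm⟩
        · exact hθr (hcα h hh hdeg _ he)) ⟨α a, by simp, ha⟩ ⟨α b, by simp, hb⟩
    refine ⟨u, v, ?_, ?_, h3, h4, ?_⟩
    · by_contra hcon
      exact h5 (α a) (by simp) (not_le.1 hcon) (ha.trans h4)
    · by_contra hcon
      exact h5 (α b) (by simp) (h3.trans hb) (not_le.1 hcon)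
    · intro x hx1 hx2 hx
      exact h5 x (by simp only [Finset.mem_insert, hroot h hh]; exact Or.inr (Or.inr hx)) hx1 hx2
  -- transferring absence of roots
  have trans : ∀ (h : k[X]), h ≠ 0 → h.natDegree < p.natDegree → ∀ u v : k,
      (∀ x, α u < x → x < α v → eval₂ α x h ≠ 0) → ∀ x, β u < x → x < β v → eval₂ β x h ≠ 0 := by
    intro h hh hdeg u v hno x h1 h2 h3
    obtain ⟨c, rfl⟩ := hcβ h hh hdeg x h3
    refine hno (α c) ((ks_lt_iff α β hs _ _).2 h1) ((ks_lt_iff α β hs _ _).2 h2) ?_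
    rw [hckβ] at h3
    rw [hck, (map_eq_zero_iff β β.injective).1 h3, map_zero]
  -- interval for p
  obtain ⟨u, v, -, -, hu, hv, huv⟩ := brk (derivative p) hp'0 hp'd (-B) B
    (by rw [map_neg]; exact hB.1) hB.2
  have huvβ := trans _ hp'0 hp'd u v huv
  have chg : ∀ a b : k, α u ≤ α a → α b ≤ α v → α a < θ → θ < α b →
      ∃ y, β a < y ∧ y < β b ∧ eval₂ β y p = 0 := by
    intro a b h1 h2 h3 h4
    have h5 := ks_change hR (p.map α) (α a) (α b) θ (by
      intro x hx1 hx2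
      rw [derivative_map, hmapα]
      exact huv x (h1.trans_lt hx1) (hx2.trans_le h2)) (by rw [hmapα]; exact hθ) h3 h4
    rw [hmapα, hmapα, hck, hck, ← map_mul, ks_neg_iff α β hs, map_mul, ← hckβ, ← hckβ, ← hmapβ,
      ← hmapβ] at h5
    obtain ⟨y, hy1, hy2, hy3⟩ := hS (p.map β) (β a) (β b)
      ((ks_lt_iff α β hs _ _).1 (h3.trans h4)) h5
    exact ⟨y, hy1, hy2, by rw [← hmapβ]; exact hy3⟩
  have le_iff : ∀ a b : k, α a ≤ α b ↔ β a ≤ β b := fun a b => by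
    rw [← not_lt, ← not_lt, ks_lt_iff α β hs]
  obtain ⟨θ', hθ1, hθ2, hθ3⟩ := chg u v le_rfl le_rfl hu hv
  refine ⟨θ', ?_⟩
  have low : ∀ h : k[X], h ≠ 0 → h.natDegree < p.natDegree →
      (0 < eval₂ α θ h ↔ 0 < eval₂ β θ' h) := by
    intro h hh hdeg
    obtain ⟨a, b, hua, hbv, ha, hb, hno⟩ := brk h hh hdeg u v hu hv
    have hnoβ := trans h hh hdeg a b hno
    obtain ⟨y, hy1, hy2, hy3⟩ := chg a b hua hbv ha hb
    have hyθ : y = θ' := ks_unique hS (p.map β) (β u) (β v) (by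
      intro x hx1 hx2
      rw [derivative_map, hmapβ]
      exact huvβ x hx1 hx2) y θ' (((le_iff _ _).1 hua).trans hy1.le)
      (hy2.le.trans ((le_iff _ _).1 hbv)) hθ1.le hθ2.le (by rw [hmapβ]; exact hy3)
      (by rw [hmapβ]; exact hθ3)
    subst hyθ
    obtain ⟨hm1, hm2⟩ := ks_mid α a b (ha.trans hb)
    have hm1' := (ks_lt_iff α β hs _ _).1 hm1
    have hm2' := (ks_lt_iff α β hs _ _).1 hm2
    have e1 := ks_sign_iff hR (h.map α) θ (α ((a + b) / 2)) (by
      intro x hx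
      rw [hmapα]
      rw [Set.mem_uIcc] at hx
      rcases hx with hx | hx
      · exact hno x (ha.trans_le hx.1) (hx.2.trans_lt hm2)
      · exact hno x (hm1.trans_le hx.1) (hx.2.trans_lt hb))
    have e2 := ks_sign_iff hS (h.map β) y (β ((a + b) / 2)) (by
      intro x hx
      rw [hmapβ]
      rw [Set.mem_uIcc] at hx
      rcases hx with hx | hx
      · exact hnoβ x (hy1.trans_le hx.1) (hx.2.trans_lt hm2')
      · exact hnoβ x (hm1'.trans_le hx.1) (hx.2.trans_lt hy2))
    rw [hmapα, hmapα, hck] at e1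
    rw [hmapβ, hmapβ, hckβ] at e2
    rw [e1, e2, hs]
  intro h
  have hdm := EuclideanDomain.mod_add_div h p
  have r1 : eval₂ α θ h = eval₂ α θ (h % p) := by
    rw [← hdm, eval₂_add, eval₂_mul, hθ, zero_mul, add_zero, hdm]
  have r2 : eval₂ β θ' h = eval₂ β θ' (h % p) := by
    rw [← hdm, eval₂_add, eval₂_mul, hθ3, zero_mul, add_zero, hdm]
  rw [r1, r2]
  by_cases h0 : h % p = 0
  · rw [h0]; simp
  · exact low _ h0 (natDegree_mod_lt h hd.ne')

/-- transcendental step, finite version -/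
theorem ks_trans_step (hR : KSIVT R) (α : k →+* R) (β : k →+* S)
    (hs : ∀ a, 0 < α a ↔ 0 < β a) (hc : ∀ d, KSClosed α d) (x : R) (H : Finset k[X]) :
    ∃ y : S, ∀ h ∈ H, (0 < eval₂ α x h ↔ 0 < eval₂ β y h) := by
  classical
  by_cases hx : ∃ u, α u = x
  · obtain ⟨u, rfl⟩ := hx
    refine ⟨β u, fun h _ => ?_⟩
    rw [eval₂_at_apply, eval₂_at_apply, hs]
  obtain ⟨c, hc⟩ := ks_near α ((H.filter (· ≠ 0)).biUnion fun h => (h.map α).roots.toFinset) (by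
    intro e he
    simp only [Finset.mem_biUnion, Finset.mem_filter, Multiset.mem_toFinset] at he
    obtain ⟨h, ⟨-, h0⟩, he⟩ := he
    have := isRoot_of_mem_roots he
    rw [IsRoot.def, eval_map] at this
    exact hc _ h h0 (Nat.lt_succ_self _) e this) x (by
    intro he
    simp only [Finset.mem_biUnion, Finset.mem_filter, Multiset.mem_toFinset] at he
    obtain ⟨h, ⟨-, h0⟩, he⟩ := he
    have := isRoot_of_mem_roots he
    rw [IsRoot.def, eval_map] at this
    exact hx (hc _ h h0 (Nat.lt_succ_self _) x this))
  refine ⟨β c, fun h hh => ?_⟩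
  by_cases h0 : h = 0
  · subst h0; simp
  have := ks_sign_iff hR (h.map α) x (α c) (by
    intro z hz h1
    refine hc z ?_ hz
    simp only [Finset.mem_biUnion, Finset.mem_filter, Multiset.mem_toFinset]
    exact ⟨h, ⟨hh, h0⟩, (mem_roots ((Polynomial.map_ne_zero_iff α.injective).2 h0)).2 h1⟩)
  rw [eval_map, eval_map, eval₂_at_apply] at this
  rw [eval₂_at_apply, this, hs]
end


section
variable {R S : Type} [Field R] [LinearOrder R] [IsStrictOrderedRing R]
  [Field S] [LinearOrder S] [IsStrictOrderedRing S]

/-- sign-matched subrings of the product -/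
def KSMatch (C : Subring (R × S)) : Prop := ∀ z ∈ C, 0 < z.1 ↔ 0 < z.2

theorem ks_match_neg (C : Subring (R × S)) (hC : KSMatch C) (z : R × S) (hz : z ∈ C) :
    z.1 < 0 ↔ z.2 < 0 := by
  have := hC (-z) (C.neg_mem hz)
  simpa using this

theorem ks_match_zero (C : Subring (R × S)) (hC : KSMatch C) (z : R × S) (hz : z ∈ C) :
    z.1 = 0 ↔ z.2 = 0 := by
  have h1 := hC z hz
  have h2 := ks_match_neg C hC z hz
  constructor
  · intro h
    rw [h] at h1 h2
    simp only [lt_irrefl, false_iff, not_lt] at h1 h2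
    exact le_antisymm h1 h2
  · intro h
    rw [h] at h1 h2
    simp only [lt_irrefl, iff_false, not_lt] at h1 h2
    exact le_antisymm h1 h2

theorem ks_match_max (C : Subring (R × S)) (hC : KSMatch C) :
    ∃ C', C ≤ C' ∧ Maximal (fun C : Subring (R × S) => KSMatch C) C' := by
  refine zorn_le_nonempty₀ {P : Subring (R × S) | KSMatch P} ?_ C hC
  intro c hc hchain y hy
  refine ⟨sSup c, ?_, fun z hz => le_sSup hz⟩
  intro z hz
  obtain ⟨s, hs, h⟩ := (Subring.mem_sSup_of_directedOn ⟨y, hy⟩ hchain.directedOn).1 hz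
  exact hc hs z h

theorem ks_match_inv (C : Subring (R × S)) (hC : Maximal (fun C : Subring (R × S) => KSMatch C) C)
    (z : R × S) (hz : z ∈ C) (h0 : 0 < z.1) : (z.1⁻¹, z.2⁻¹) ∈ C := by
  let C' : Subring (R × S) :=
    { carrier := {x | ∃ c ∈ C, 0 < c.1 ∧ x * c ∈ C}
      zero_mem' := ⟨1, C.one_mem, one_pos, by simp⟩
      one_mem' := ⟨1, C.one_mem, one_pos, by simp⟩
      neg_mem' := by
        rintro x ⟨c, hc, hc0, hx⟩
        exact ⟨c, hc, hc0, by rw [neg_mul]; exact C.neg_mem hx⟩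
      add_mem' := by
        rintro x y ⟨c, hc, hc0, hx⟩ ⟨d, hd, hd0, hy⟩
        refine ⟨c * d, C.mul_mem hc hd, mul_pos hc0 hd0, ?_⟩
        have := C.add_mem (C.mul_mem hx hd) (C.mul_mem hy hc)
        convert this using 1; ring
      mul_mem' := by
        rintro x y ⟨c, hc, hc0, hx⟩ ⟨d, hd, hd0, hy⟩
        refine ⟨c * d, C.mul_mem hc hd, mul_pos hc0 hd0, ?_⟩
        have := (C.mul_mem hx hy)
        convert this using 1; ring }
  have hC' : KSMatch C' := by
    rintro x ⟨c, hc, hc0, hx⟩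
    have h1 := hC.prop _ hx
    have h2 := (hC.prop _ hc).1 hc0
    simp only [Prod.fst_mul, Prod.snd_mul] at h1
    rwa [mul_pos_iff_of_pos_right hc0, mul_pos_iff_of_pos_right h2] at h1
  have hle : C' ≤ C := hC.le_of_ge hC' fun x hx => ⟨1, C.one_mem, one_pos, by simpa using hx⟩
  refine hle ⟨z, hz, h0, ?_⟩
  have h2 := (hC.prop _ hz).1 h0
  have : ((z.1⁻¹, z.2⁻¹) : R × S) * z = 1 := by
    ext
    · simp [h0.ne']
    · simp [h2.ne']
  rw [this]; exact C.one_mem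

theorem ks_max_field (C : Subring (R × S))
    (hC : Maximal (fun C : Subring (R × S) => KSMatch C) C) :
    ∃ (k : Type) (_ : Field k) (α : k →+* R) (β : k →+* S), (∀ a, 0 < α a ↔ 0 < β a) ∧
      ∀ z, z ∈ C ↔ ∃ a, α a = z.1 ∧ β a = z.2 := by
  have hf : IsField C := by
    refine ⟨⟨0, 1, ?_⟩, mul_comm, ?_⟩
    · intro h
      have := congrArg (fun z : C => (z : R × S).1) h
      simp at this
    · intro a ha
      have ha1 : (a : R × S).1 ≠ 0 := by
        intro h
        have h2 := (ks_match_zero C hC.prop a a.2).1 h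
        apply ha; apply Subtype.ext; exact Prod.ext h h2
      have ha2 : (a : R × S).2 ≠ 0 := fun h => ha1 ((ks_match_zero C hC.prop a a.2).2 h)
      have hmem : ((a : R × S).1⁻¹, (a : R × S).2⁻¹) ∈ C := by
        rcases lt_or_gt_of_ne ha1 with h | h
        · have := ks_match_inv C hC (-a) (C.neg_mem a.2) (by simpa using h)
          have := C.neg_mem this
          simpa [inv_neg] using this
        · exact ks_match_inv C hC a a.2 h
      refine ⟨⟨_, hmem⟩, ?_⟩
      apply Subtype.ext
      ext
      · simp [ha1]
      · simp [ha2]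
  refine ⟨C, hf.toField, (RingHom.fst R S).comp C.subtype, (RingHom.snd R S).comp C.subtype, ?_, ?_⟩
  · intro a
    exact hC.prop a a.2
  · intro z
    constructor
    · intro hz; exact ⟨⟨z, hz⟩, rfl, rfl⟩
    · rintro ⟨a, h1, h2⟩
      have : z = a := Prod.ext h1.symm h2.symm
      rw [this]; exact a.2

theorem ks_max_closed (hR : KSIVT R) (hS : KSIVT S) (C : Subring (R × S))
    (hC : Maximal (fun C : Subring (R × S) => KSMatch C) C)
    (k : Type) [Field k] (α : k →+* R) (β : k →+* S) (hs : ∀ a, 0 < α a ↔ 0 < β a)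
    (hk : ∀ z, z ∈ C ↔ ∃ a, α a = z.1 ∧ β a = z.2) (d : ℕ) : KSClosed α d ∧ KSClosed β d := by
  have ext : ∀ θ θ', (∀ h : k[X], 0 < eval₂ α θ h ↔ 0 < eval₂ β θ' h) →
      ∃ a, α a = θ ∧ β a = θ' := by
    intro θ θ' h
    have hle := hC.le_of_ge
      (y := ((eval₂RingHom α θ).prod (eval₂RingHom β θ')).range) (by
        rintro _ ⟨q, rfl⟩
        exact h q) (by
        intro z hz
        obtain ⟨a, h1, h2⟩ := (hk z).1 hz
        exact ⟨Polynomial.C a, by ext <;> simp [h1, h2]⟩)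
    exact (hk (θ, θ')).1 (hle ⟨X, by simp⟩)
  induction d with
  | zero => exact ⟨fun p _ h => absurd h (by omega), fun p _ h => absurd h (by omega)⟩
  | succ d ih =>
    constructor
    · intro p hp hdeg x hx
      by_cases hlt : p.natDegree < d
      · exact ih.1 p hp hlt x hx
      have hd : p.natDegree = d := by omega
      by_contra hcon
      obtain ⟨θ', h⟩ := ks_alg_step hR hS α β hs p hp (hd ▸ ih.1) (hd ▸ ih.2) x hx hcon
      obtain ⟨a, ha, -⟩ := ext x θ' h
      exact hcon ⟨a, ha⟩
    · intro p hp hdeg x hx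
      by_cases hlt : p.natDegree < d
      · exact ih.2 p hp hlt x hx
      have hd : p.natDegree = d := by omega
      by_contra hcon
      obtain ⟨θ', h⟩ := ks_alg_step hS hR β α (fun a => (hs a).symm) p hp (hd ▸ ih.2)
        (hd ▸ ih.1) x hx hcon
      obtain ⟨a, -, ha⟩ := ext θ' x (fun q => (h q).symm)
      exact hcon ⟨a, ha⟩

end

section
variable {I S : Type} [Field S] [LinearOrder S] [IsStrictOrderedRing S] (U : Ultrafilter I)

/-- constants -/
noncomputable def ksConst : S →+* (U : Filter I).Germ S :=
  (Filter.Germ.coeRingHom (U : Filter I)).comp (Pi.constRingHom I S)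

theorem ks_germ_poly (p : ((U : Filter I).Germ S)[X]) : ∃ P : I → S[X], ∀ x : I → S,
    p.eval (x : (U : Filter I).Germ S) = ((fun i => (P i).eval (x i) : I → S) : (U : Filter I).Germ S) := by
  induction p using Polynomial.induction_on' with
  | add p q hp hq =>
    obtain ⟨P, hP⟩ := hp
    obtain ⟨Q, hQ⟩ := hq
    refine ⟨fun i => P i + Q i, fun x => ?_⟩
    rw [eval_add, hP, hQ, ← Filter.Germ.coe_add]
    congr 1; funext i; simp
  | monomial n a =>
    induction a using Filter.Germ.inductionOn with
    | h a =>
    refine ⟨fun i => monomial n (a i), fun x => ?_⟩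
    rw [eval_monomial, ← Filter.Germ.coe_pow, ← Filter.Germ.coe_mul]
    congr 1; funext i; simp

theorem ks_germ_ivt (hS : KSIVT S) : KSIVT ((U : Filter I).Germ S) := by
  intro p a b hab h
  obtain ⟨P, hP⟩ := ks_germ_poly U p
  induction a using Filter.Germ.inductionOn with
  | h a =>
  induction b using Filter.Germ.inductionOn with
  | h b =>
  rw [hP, hP, ← Filter.Germ.coe_mul] at h
  have h' : ∀ᶠ i in (U : Filter I), (P i).eval (a i) * (P i).eval (b i) < 0 :=
    Filter.Germ.coe_lt.1 h
  have hab' : ∀ᶠ i in (U : Filter I), a i < b i := Filter.Germ.coe_lt.1 hab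
  have hex : ∀ i, ∃ c, a i < b i → (P i).eval (a i) * (P i).eval (b i) < 0 →
      (a i < c ∧ c < b i ∧ (P i).eval c = 0) := by
    intro i
    by_cases h1 : a i < b i ∧ (P i).eval (a i) * (P i).eval (b i) < 0
    · obtain ⟨c, hc⟩ := hS (P i) _ _ h1.1 h1.2
      exact ⟨c, fun _ _ => hc⟩
    · exact ⟨0, fun h2 h3 => absurd ⟨h2, h3⟩ h1⟩
  choose c hc using hex
  refine ⟨(c : (U : Filter I).Germ S), ?_, ?_, ?_⟩
  · refine Filter.Germ.coe_lt.2 ?_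
    filter_upwards [h', hab'] with i h1 h2 using (hc i h2 h1).1
  · refine Filter.Germ.coe_lt.2 ?_
    filter_upwards [h', hab'] with i h1 h2 using (hc i h2 h1).2.1
  · rw [hP]
    refine Filter.Germ.coe_eq.2 ?_
    filter_upwards [h', hab'] with i h1 h2 using (hc i h2 h1).2.2

theorem ks_germ_mv {n : ℕ} (ι : ℝ →+* S) (q : MvPolynomial (Fin n) ℝ) (x : Fin n → I → S) :
    MvPolynomial.eval₂ ((ksConst U).comp ι) (fun j => ((x j : I → S) : (U : Filter I).Germ S)) q =
      ((fun i => MvPolynomial.eval₂ ι (fun j => x j i) q : I → S) : (U : Filter I).Germ S) := by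
  induction q using MvPolynomial.induction_on with
  | C a => simp [ksConst]; rfl
  | add p q hp hq =>
    simp only [MvPolynomial.eval₂_add]
    rw [hp, hq, ← Filter.Germ.coe_add]; rfl
  | mul_X p j hp =>
    simp only [MvPolynomial.eval₂_mul, MvPolynomial.eval₂_X]
    rw [hp, ← Filter.Germ.coe_mul]; rfl

theorem ks_germ_eval₂ {k : Type} [Field k] (β : k →+* S) (q : k[X]) (x : I → S) :
    eval₂ ((ksConst U).comp β) (x : (U : Filter I).Germ S) q =
      ((fun i => eval₂ β (x i) q : I → S) : (U : Filter I).Germ S) := by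
  induction q using Polynomial.induction_on' with
  | add p q hp hq =>
    simp only [eval₂_add]
    rw [hp, hq, ← Filter.Germ.coe_add]; rfl
  | monomial n a =>
    simp only [eval₂_monomial]
    rw [← Filter.Germ.coe_pow]; rfl
end

/-- solvability transfers to `ℝ` -/
def KSTr {n r s : ℕ} (f : Fin r → MvPolynomial (Fin n) ℝ) (g : Fin s → MvPolynomial (Fin n) ℝ)
    (S : Type) [Field S] [LinearOrder S] (ι : ℝ →+* S) : Prop :=
  (∃ x : Fin n → S, (∀ i, 0 ≤ MvPolynomial.eval₂ ι x (f i)) ∧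
      ∀ j, MvPolynomial.eval₂ ι x (g j) = 0) →
    ∃ x : Fin n → ℝ, (∀ i, 0 ≤ MvPolynomial.eval x (f i)) ∧ ∀ j, MvPolynomial.eval x (g j) = 0

theorem ks_germ_tr {n r s : ℕ} (f : Fin r → MvPolynomial (Fin n) ℝ)
    (g : Fin s → MvPolynomial (Fin n) ℝ) {I S : Type} [Field S] [LinearOrder S]
    [IsStrictOrderedRing S] (ι : ℝ →+* S) (U : Ultrafilter I) (h : KSTr f g S ι) :
    KSTr f g ((U : Filter I).Germ S) ((ksConst U).comp ι) := by
  rintro ⟨x, hx1, hx2⟩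
  have hrep : ∀ j, ∃ y : I → S, x j = (y : (U : Filter I).Germ S) := fun j => by
    induction x j using Filter.Germ.inductionOn with
    | h a => exact ⟨a, rfl⟩
  choose y hy using hrep
  have hxy : x = fun j => ((y j : I → S) : (U : Filter I).Germ S) := funext hy
  subst hxy
  simp only [ks_germ_mv] at hx1 hx2
  have h1 : ∀ᶠ a in (U : Filter I), ∀ i, 0 ≤ MvPolynomial.eval₂ ι (fun j => y j a) (f i) :=
    Filter.eventually_all.2 fun i => Filter.Germ.coe_le.1 (hx1 i)
  have h2 : ∀ᶠ a in (U : Filter I), ∀ i, MvPolynomial.eval₂ ι (fun j => y j a) (g i) = 0 :=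
    Filter.eventually_all.2 fun i => Filter.Germ.coe_eq.1 (hx2 i)
  obtain ⟨a, ha1, ha2⟩ := (h1.and h2).exists
  exact h ⟨fun j => y j a, ha1, ha2⟩

theorem ks_real_pos {R : Type} [Field R] [LinearOrder R] [IsStrictOrderedRing R] (ρ : ℝ →+* R)
    (a : ℝ) : 0 < ρ a ↔ 0 < a := by
  have key : ∀ b : ℝ, 0 < b → 0 < ρ b := by
    intro b hb
    have : ρ b = ρ (√b) * ρ (√b) := by rw [← map_mul, Real.mul_self_sqrt hb.le]
    rw [this]
    exact mul_self_pos.2 ((map_ne_zero ρ).2 (Real.sqrt_pos.2 hb).ne')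
  refine ⟨fun h => ?_, key a⟩
  by_contra hcon
  rcases (not_lt.1 hcon).eq_or_lt with h0 | h0
  · subst h0; simp at h
  · have := key (-a) (by linarith)
    rw [map_neg] at this; linarith

theorem ks_real_ivt : KSIVT ℝ := by
  refine fun p a b hab h => ?_
  have hc : ContinuousOn (fun x => p.eval x) (Set.Icc a b) := p.continuous.continuousOn
  rcases mul_neg_iff.1 h with ⟨h1, h2⟩ | ⟨h1, h2⟩
  · obtain ⟨c, hc1, hc2⟩ := intermediate_value_Ioo' hab.le hc ⟨h2, h1⟩
    exact ⟨c, hc1.1, hc1.2, hc2⟩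
  · obtain ⟨c, hc1, hc2⟩ := intermediate_value_Ioo hab.le hc ⟨h1, h2⟩
    exact ⟨c, hc1.1, hc1.2, hc2⟩

theorem ks_tower {n r s : ℕ} (f : Fin r → MvPolynomial (Fin n) ℝ)
    (g : Fin s → MvPolynomial (Fin n) ℝ) {R : Type} [Field R] [LinearOrder R]
    [IsStrictOrderedRing R] (hR : KSIVT R) (ρ : ℝ →+* R) (E : Finset R) :
    ∃ (S : Type) (_ : Field S) (_ : LinearOrder S) (_ : IsStrictOrderedRing S) (ι : ℝ →+* S),
      KSIVT S ∧ KSTr f g S ι ∧ ∃ C : Subring (R × S), KSMatch C ∧ (∀ a, (ρ a, ι a) ∈ C) ∧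
        ∀ x ∈ E, ∃ y, (x, y) ∈ C := by
  classical
  induction E using Finset.induction_on with
  | empty =>
    refine ⟨ℝ, inferInstance, inferInstance, inferInstance, RingHom.id ℝ, ks_real_ivt, ?_,
      (ρ.prod (RingHom.id ℝ)).range, ?_, fun a => ⟨a, rfl⟩, by simp⟩
    · rintro ⟨x, h1, h2⟩
      exact ⟨x, h1, h2⟩
    · rintro _ ⟨a, rfl⟩
      exact ks_real_pos ρ a
  | insert x E _ ih =>
    obtain ⟨S, _, _, _, ι, hS, hTr, C, hC, hCι, hCE⟩ := ih
    obtain ⟨C', hle, hmax⟩ := ks_match_max C hC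
    obtain ⟨k, _, α, β, hs, hk⟩ := ks_max_field C' hmax
    have hcl : ∀ d, KSClosed α d := fun d => (ks_max_closed hR hS C' hmax k α β hs hk d).1
    choose y hy using fun H : Finset k[X] => ks_trans_step (S := S) hR α β hs hcl x H
    let U : Ultrafilter (Finset k[X]) := Ultrafilter.of Filter.atTop
    let β' : k →+* (U : Filter (Finset k[X])).Germ S := (ksConst U).comp β
    refine ⟨(U : Filter (Finset k[X])).Germ S, inferInstance, inferInstance, inferInstance,
      (ksConst U).comp ι, ks_germ_ivt U hS, ks_germ_tr f g ι U hTr,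
      ((eval₂RingHom α x).prod (eval₂RingHom β' (y : (U : Filter (Finset k[X])).Germ S))).range,
      ?_, ?_, ?_⟩
    · rintro _ ⟨h, rfl⟩
      have hev : ∀ᶠ H in (U : Filter (Finset k[X])), h ∈ H := by
        have h1 : ∀ᶠ H in (Filter.atTop : Filter (Finset k[X])), h ∈ H := by
          filter_upwards [Filter.eventually_ge_atTop ({h} : Finset k[X])] with H hH
          exact hH (by simp)
        exact Ultrafilter.of_le _ h1
      change 0 < eval₂ α x h ↔ 0 < eval₂ β' (y : (U : Filter (Finset k[X])).Germ S) h
      rw [ks_germ_eval₂ U β h y, Filter.Germ.coe_pos]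
      constructor
      · intro h0
        filter_upwards [hev] with H hH
        exact (hy H h hH).1 h0
      · intro h0
        obtain ⟨H, h1, h2⟩ := (Filter.Eventually.and hev h0).exists
        exact (hy H h h1).2 h2
    · intro a
      obtain ⟨b, hb1, hb2⟩ := (hk _).1 (hle (hCι a))
      refine ⟨Polynomial.C b, ?_⟩
      ext
      · simpa using hb1
      · simp [β', hb2]
    · intro z hz
      rcases Finset.mem_insert.1 hz with rfl | hz
      · exact ⟨_, X, by ext <;> simp; rfl⟩
      · obtain ⟨w, hw⟩ := hCE z hz
        obtain ⟨b, hb1, hb2⟩ := (hk _).1 (hle hw)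
        exact ⟨β' b, Polynomial.C b, by ext <;> simp [hb1]⟩

theorem ks_transfer {n r s : ℕ} (f : Fin r → MvPolynomial (Fin n) ℝ)
    (g : Fin s → MvPolynomial (Fin n) ℝ) {R : Type} [Field R] [LinearOrder R]
    [IsStrictOrderedRing R] (hR : KSIVT R) (ρ : ℝ →+* R) : KSTr f g R ρ := by
  classical
  rintro ⟨x, hx1, hx2⟩
  obtain ⟨S, _, _, _, ι, hS, hTr, C, hC, hCι, hCE⟩ := ks_tower f g hR ρ (Finset.univ.image x)
  choose y hy using fun j => hCE (x j) (by simp)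
  have hmem : ∀ q : MvPolynomial (Fin n) ℝ,
      (MvPolynomial.eval₂ ρ x q, MvPolynomial.eval₂ ι y q) ∈ C := by
    intro q
    induction q using MvPolynomial.induction_on with
    | C a => simpa using hCι a
    | add p q hp hq => simpa using C.add_mem hp hq
    | mul_X p j hp => simpa using C.mul_mem hp (hy j)
  apply hTr
  refine ⟨y, fun i => ?_, fun j => ?_⟩
  · have := ks_match_neg C hC _ (hmem (f i))
    have h2 := hx1 i
    simp only at this
    rw [← not_lt, ← this, not_lt]; exact h2
  · exact (ks_match_zero C hC _ (hmem (g j))).1 (hx2 j)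


section
variable {n r s : ℕ}

theorem ks_sos_zero : IsSOS (0 : MvPolynomial (Fin n) ℝ) := ⟨0, fun _ => 0, by simp⟩

theorem ks_sos_one : IsSOS (1 : MvPolynomial (Fin n) ℝ) := ⟨1, fun _ => 1, by simp⟩

theorem ks_sos_add {a b : MvPolynomial (Fin n) ℝ} (ha : IsSOS a) (hb : IsSOS b) :
    IsSOS (a + b) := by
  obtain ⟨k, p, rfl⟩ := ha
  obtain ⟨l, q, rfl⟩ := hb
  exact ⟨k + l, Fin.append p q, by simp [Fin.sum_univ_add]⟩

theorem ks_sos_mul {a : MvPolynomial (Fin n) ℝ} (c : MvPolynomial (Fin n) ℝ) (ha : IsSOS a) :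
    IsSOS (c * c * a) := by
  obtain ⟨k, p, rfl⟩ := ha
  refine ⟨k, fun i => c * p i, ?_⟩
  rw [Finset.mul_sum]
  exact Finset.sum_congr rfl fun i _ => by ring

variable (f : Fin r → MvPolynomial (Fin n) ℝ) (g : Fin s → MvPolynomial (Fin n) ℝ)

theorem ks_pre_zero : InPreorder f g 0 :=
  ⟨fun _ => 0, fun _ => 0, fun _ => ks_sos_zero, by simp⟩

theorem ks_pre_one : InPreorder f g 1 := by
  classical
  refine ⟨fun ε => if ε = fun _ => false then 1 else 0, fun _ => 0, fun ε => ?_, ?_⟩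
  · dsimp only
    split_ifs
    · exact ks_sos_one
    · exact ks_sos_zero
  · simp [ite_mul]

theorem ks_pre_add {a b : MvPolynomial (Fin n) ℝ} (ha : InPreorder f g a)
    (hb : InPreorder f g b) : InPreorder f g (a + b) := by
  obtain ⟨σ, p, h, rfl⟩ := ha
  obtain ⟨τ, q, h', rfl⟩ := hb
  refine ⟨fun ε => σ ε + τ ε, fun j => p j + q j, fun ε => ks_sos_add (h ε) (h' ε), ?_⟩
  simp only [add_mul, Finset.sum_add_distrib]
  ring

theorem ks_pre_sq {a : MvPolynomial (Fin n) ℝ} (c : MvPolynomial (Fin n) ℝ)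
    (ha : InPreorder f g a) : InPreorder f g (c * c * a) := by
  obtain ⟨σ, p, h, rfl⟩ := ha
  refine ⟨fun ε => c * c * σ ε, fun j => c * c * p j, fun ε => ks_sos_mul c (h ε), ?_⟩
  simp only [mul_add, Finset.mul_sum, mul_assoc]

theorem ks_pre_g (c : MvPolynomial (Fin n) ℝ) (j : Fin s) : InPreorder f g (c * g j) := by
  classical
  exact ⟨fun _ => 0, fun i => if i = j then c else 0, fun _ => ks_sos_zero, by simp [ite_mul]⟩

theorem ks_pre_f {a : MvPolynomial (Fin n) ℝ} (i : Fin r)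
    (ha : InPreorder f g a) : InPreorder f g (f i * a) := by
  classical
  obtain ⟨σ, p, h, rfl⟩ := ha
  let fl : (Fin r → Bool) → (Fin r → Bool) := fun ε => Function.update ε i (!ε i)
  have hfl : Function.Involutive fl := by
    intro ε
    simp [fl]
  let e : (Fin r → Bool) ≃ (Fin r → Bool) := hfl.toPerm
  have he : ∀ ε, e ε = fl ε := fun ε => rfl
  refine ⟨fun ε => (if fl ε i then f i else 1) * (if fl ε i then f i else 1) * σ (fl ε),
    fun j => f i * p j, fun ε => ks_sos_mul _ (h _), ?_⟩
  rw [← Equiv.sum_comp e, mul_add, Finset.mul_sum, Finset.mul_sum]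
  congr 1
  · refine Finset.sum_congr rfl fun ε _ => ?_
    rw [he]; dsimp only
    rw [← Finset.mul_prod_erase Finset.univ (fun j => if fl ε j then f j else 1) (Finset.mem_univ i),
      ← Finset.mul_prod_erase Finset.univ (fun j => if ε j then f j else 1) (Finset.mem_univ i)]
    have : ∏ j ∈ Finset.univ.erase i, (if fl ε j then f j else 1)
        = ∏ j ∈ Finset.univ.erase i, (if ε j then f j else 1) := by
      refine Finset.prod_congr rfl fun j hj => ?_
      simp [fl, Function.update_of_ne (Finset.ne_of_mem_erase hj)]
    rw [this]
    cases hb : ε i <;> simp [fl, hb] <;> ring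
  · exact Finset.sum_congr rfl fun j _ => by ring

/-- the preorder as a subsemiring -/
noncomputable def ksT : Subsemiring (MvPolynomial (Fin n) ℝ) :=
  Subsemiring.closure ({x | ∃ a, x = a * a} ∪ {x | ∃ i, x = f i} ∪ {x | ∃ c j, x = c * g j})

theorem ksT_pre (x : MvPolynomial (Fin n) ℝ) (hx : x ∈ ksT f g) : InPreorder f g x := by
  have key : ∀ q, InPreorder f g q → InPreorder f g (x * q) := by
    refine Subsemiring.closure_induction
      (p := fun x _ => ∀ q, InPreorder f g q → InPreorder f g (x * q)) ?_ ?_ ?_ ?_ ?_ hx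
    · rintro y ((⟨a, rfl⟩ | ⟨i, rfl⟩) | ⟨c, j, rfl⟩) q hq
      · exact ks_pre_sq f g a hq
      · exact ks_pre_f f g i hq
      · have := ks_pre_g f g (c * q) j
        rwa [mul_right_comm] at this
    · intro q _
      rw [zero_mul]; exact ks_pre_zero f g
    · intro q hq
      rwa [one_mul]
    · intro y z _ _ hy hz q hq
      rw [add_mul]; exact ks_pre_add f g (hy q hq) (hz q hq)
    · intro y z _ _ hy hz q hq
      rw [mul_assoc]; exact hy _ (hz q hq)
  simpa using key 1 (ks_pre_one f g)

theorem ks_sos_eval {a : MvPolynomial (Fin n) ℝ} (ha : IsSOS a) (x : Fin n → ℝ) :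
    0 ≤ MvPolynomial.eval x a := by
  obtain ⟨k, p, rfl⟩ := ha
  rw [map_sum]
  exact Finset.sum_nonneg fun i _ => by rw [map_pow]; positivity

end

end

/-- Krivine–Stengle Positivstellensatz (emptiness form):
`K = {x : fᵢ(x) ≥ 0, gⱼ(x) = 0}` is empty iff `-1` lies in the preorder. -/
theorem ks_positivstellensatz_empty {n r s : ℕ}
    (f : Fin r → MvPolynomial (Fin n) ℝ) (g : Fin s → MvPolynomial (Fin n) ℝ) :
    (¬ ∃ x : Fin n → ℝ,
        (∀ i : Fin r, 0 ≤ MvPolynomial.eval x (f i)) ∧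
        (∀ j : Fin s, MvPolynomial.eval x (g j) = 0)) ↔
      InPreorder f g (-1) := by
  constructor
  · intro hK
    by_contra hP
    apply hK
    have h1 : (-1 : MvPolynomial (Fin n) ℝ) ∉ ksT f g := fun h => hP (ksT_pre f g _ h)
    obtain ⟨Q, hTQ, hQ⟩ := ks_exists_cone (ksT f g)
      (fun a => Subsemiring.subset_closure (Or.inl (Or.inl ⟨a, rfl⟩))) h1
    obtain ⟨R, _, _, _, φ, hR, hφ⟩ := ks_real_closure Q hQ
    have hev : ∀ q, MvPolynomial.eval₂ (φ.comp MvPolynomial.C)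
        (fun j => φ (MvPolynomial.X j)) q = φ q := by
      intro q
      induction q using MvPolynomial.induction_on with
      | C a => simp
      | add p q hp hq => simp only [MvPolynomial.eval₂_add, map_add, hp, hq]
      | mul_X p j hp => simp only [MvPolynomial.eval₂_mul, MvPolynomial.eval₂_X, map_mul, hp]
    have hg : ∀ c j, 0 ≤ φ (c * g j) := fun c j =>
      hφ _ (hTQ (Subsemiring.subset_closure (Or.inr ⟨c, j, rfl⟩)))
    refine ks_transfer f g hR (φ.comp MvPolynomial.C)
      ⟨fun j => φ (MvPolynomial.X j), fun i => ?_, fun j => ?_⟩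
    · rw [hev]
      exact hφ _ (hTQ (Subsemiring.subset_closure (Or.inl (Or.inr ⟨i, rfl⟩))))
    · rw [hev]
      have h2 := hg 1 j
      have h3 := hg (-1) j
      rw [one_mul] at h2
      rw [neg_one_mul, map_neg] at h3
      exact le_antisymm (neg_nonneg.1 h3) h2
  · rintro ⟨σ, p, hσ, he⟩ ⟨x, hf, hg⟩
    have h := congrArg (MvPolynomial.eval x) he
    simp only [map_neg, map_one, map_add, map_sum, map_mul, hg, mul_zero, Finset.sum_const_zero,
      add_zero, map_prod] at h
    have h0 : 0 ≤ ∑ ε : Fin r → Bool, MvPolynomial.eval x (σ ε) *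
        ∏ i, MvPolynomial.eval x (if ε i then f i else 1) := by
      refine Finset.sum_nonneg fun ε _ => mul_nonneg (ks_sos_eval (hσ ε) x) ?_
      refine Finset.prod_nonneg fun i _ => ?_
      split_ifs
      · exact hf i
      · simp
    linarith
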